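/- Let R be a commutative ring, C a semidualizing R-module, M an R-module, and n a nonnegative integer. Then M has projective dimension at most n if and only if there exists an exact sequence 0 → C ⊗_R P_n → ⋯ → C ⊗_R P_1 → C ⊗_R P_0 → C ⊗_R M → 0 with each P_i a projective R-module. Consequently pd_R(M) equals the P_C-projective dimension of C ⊗_R M. -/

import Mathlib

open TensorProduct CategoryTheory

noncomputable section

/-- The natural evaluation map `ν_M : C ⊗_R Hom_R(C,M) → M`, `c ⊗ f ↦ f c`. -/
def evalNu (R : Type) [CommRing R] (C : Type) [AddCommGroup C] [Module R C]
    (M : Type) [AddCommGroup M] [Module R M] :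
    (C ⊗[R] (C →ₗ[R] M)) →ₗ[R] M :=
  TensorProduct.lift LinearMap.applyₗ

/-- The natural map `μ_M : M → Hom_R(C, C ⊗_R M)`, `m ↦ (c ↦ c ⊗ m)`. -/
def muMap (R : Type) [CommRing R] (C : Type) [AddCommGroup C] [Module R C]
    (M : Type) [AddCommGroup M] [Module R M] :
    M →ₗ[R] (C →ₗ[R] (C ⊗[R] M)) :=
  (TensorProduct.mk R C M).flip

/-- `Ext^i_R(A,B)`. -/
def extMod (R : Type) [CommRing R] (A : Type) [AddCommGroup A] [Module R A]
    (B : Type) [AddCommGroup B] [Module R B] (i : ℕ) : ModuleCat R :=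
  ((Ext R (ModuleCat R) i).obj (Opposite.op (ModuleCat.of R A))).obj (ModuleCat.of R B)

/-- `Tor_i^R(A,B)`. -/
def torMod (R : Type) [CommRing R] (A : Type) [AddCommGroup A] [Module R A]
    (B : Type) [AddCommGroup B] [Module R B] (i : ℕ) : ModuleCat R :=
  ((Tor (ModuleCat R) i).obj (ModuleCat.of R A)).obj (ModuleCat.of R B)

/-- A semidualizing module: `C` admits a degreewise finite projective resolution,
the homothety map `R → Hom_R(C,C)` is bijective, and `Ext^i_R(C,C) = 0` for `i ≥ 1`. -/
def IsSemidualizing (R : Type) [CommRing R] (C : Type) [AddCommGroup C] [Module R C] :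
    Prop :=
  (∃ (P : ℕ → ModuleCat.{0} R) (d : ∀ n, ↥(P (n + 1)) →ₗ[R] ↥(P n)) (ε : ↥(P 0) →ₗ[R] C),
      (∀ n, Module.Finite R ↥(P n)) ∧ (∀ n, Module.Projective R ↥(P n)) ∧
      Function.Surjective ε ∧ Function.Exact (d 0) ε ∧
      ∀ n, Function.Exact (d (n + 1)) (d n)) ∧
  Function.Bijective (fun r : R => (r • LinearMap.id : C →ₗ[R] C)) ∧
  ∀ i : ℕ, 1 ≤ i → Subsingleton (extMod R C C i)

/-- The Bass class `B_C`. -/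
def MemBassClass (R : Type) [CommRing R] (C : Type) [AddCommGroup C] [Module R C]
    (M : Type) [AddCommGroup M] [Module R M] : Prop :=
  (∀ i : ℕ, 1 ≤ i → Subsingleton (extMod R C M i)) ∧
  (∀ i : ℕ, 1 ≤ i → Subsingleton (torMod R C (C →ₗ[R] M) i)) ∧
  Function.Bijective (evalNu R C M)

/-- The Auslander class `A_C`. -/
def MemAuslanderClass (R : Type) [CommRing R] (C : Type) [AddCommGroup C] [Module R C]
    (M : Type) [AddCommGroup M] [Module R M] : Prop :=
  (∀ i : ℕ, 1 ≤ i → Subsingleton (torMod R C M i)) ∧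
  (∀ i : ℕ, 1 ≤ i → Subsingleton (extMod R C (C ⊗[R] M) i)) ∧
  Function.Bijective (muMap R C M)

/-- `X⁺ : ⋯ → C ⊗ P₁ → C ⊗ P₀ → M → 0` is an augmented proper `P_C`-projective resolution:
each `Pᵢ` is projective, it is a complex, and `Hom_R(C ⊗ Q, X⁺)` is exact for each
projective module `Q`. -/
def IsAugProperRes (R : Type) [CommRing R] (C : Type) [AddCommGroup C] [Module R C]
    (M : Type) [AddCommGroup M] [Module R M] (P : ℕ → ModuleCat.{0} R)
    (d : ∀ n : ℕ, (C ⊗[R] ↥(P (n + 1))) →ₗ[R] (C ⊗[R] ↥(P n)))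
    (ε : (C ⊗[R] ↥(P 0)) →ₗ[R] M) : Prop :=
  (∀ n, Module.Projective R ↥(P n)) ∧
  (∀ n, (d n).comp (d (n + 1)) = 0) ∧ (ε.comp (d 0) = 0) ∧
  ∀ (Q : Type) [AddCommGroup Q] [Module R Q], Module.Projective R Q →
    Function.Surjective (fun g : (C ⊗[R] Q) →ₗ[R] (C ⊗[R] ↥(P 0)) => ε.comp g) ∧
    Function.Exact (fun g : (C ⊗[R] Q) →ₗ[R] (C ⊗[R] ↥(P 1)) => (d 0).comp g)
      (fun g : (C ⊗[R] Q) →ₗ[R] (C ⊗[R] ↥(P 0)) => ε.comp g) ∧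
    ∀ n : ℕ, Function.Exact
      (fun g : (C ⊗[R] Q) →ₗ[R] (C ⊗[R] ↥(P (n + 2))) => (d (n + 1)).comp g)
      (fun g : (C ⊗[R] Q) →ₗ[R] (C ⊗[R] ↥(P (n + 1))) => (d n).comp g)

/-- Exactness of the augmented complex `⋯ → C ⊗ P₁ → C ⊗ P₀ → M → 0`. -/
def ResExact (R : Type) [CommRing R] (C : Type) [AddCommGroup C] [Module R C]
    (M : Type) [AddCommGroup M] [Module R M] (P : ℕ → ModuleCat.{0} R)
    (d : ∀ n : ℕ, (C ⊗[R] ↥(P (n + 1))) →ₗ[R] (C ⊗[R] ↥(P n)))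
    (ε : (C ⊗[R] ↥(P 0)) →ₗ[R] M) : Prop :=
  Function.Surjective ε ∧ Function.Exact (d 0) ε ∧
    ∀ n : ℕ, Function.Exact (d (n + 1)) (d n)

/-- Exactness of the augmented complex in all degrees `< n`
(`C ⊗ Pᵢ` in degree `i`, `M` in degree `-1`). -/
def ResExactLT (R : Type) [CommRing R] (C : Type) [AddCommGroup C] [Module R C]
    (M : Type) [AddCommGroup M] [Module R M] (P : ℕ → ModuleCat.{0} R)
    (d : ∀ n : ℕ, (C ⊗[R] ↥(P (n + 1))) →ₗ[R] (C ⊗[R] ↥(P n)))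
    (ε : (C ⊗[R] ↥(P 0)) →ₗ[R] M) (n : ℕ) : Prop :=
  Function.Surjective ε ∧ (0 < n → Function.Exact (d 0) ε) ∧
    ∀ i : ℕ, i + 1 < n → Function.Exact (d (i + 1)) (d i)


/-- An exact sequence `0 → C ⊗ P_n → ⋯ → C ⊗ P_1 → C ⊗ P_0 → M → 0`
with each `P_i` projective (encoded by an `ℕ`-indexed complex which vanishes
in degrees `> n`). -/
def HasBoundedExactCRes (R : Type) [CommRing R] (C : Type) [AddCommGroup C] [Module R C]
    (M : Type) [AddCommGroup M] [Module R M] (n : ℕ) : Prop :=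
  ∃ (P : ℕ → ModuleCat.{0} R)
    (d : ∀ i : ℕ, (C ⊗[R] ↥(P (i + 1))) →ₗ[R] (C ⊗[R] ↥(P i)))
    (ε : (C ⊗[R] ↥(P 0)) →ₗ[R] M),
      (∀ i, Module.Projective R ↥(P i)) ∧ ResExact R C M P d ε ∧
      ∀ i, n < i → Subsingleton (C ⊗[R] ↥(P i))

/-- `M` has finite `P_C`-projective dimension. -/
def HasFinCPd (R : Type) [CommRing R] (C : Type) [AddCommGroup C] [Module R C]
    (M : Type) [AddCommGroup M] [Module R M] : Prop :=
  ∃ n : ℕ, HasBoundedExactCRes R C M n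

/-- `M` has projective dimension at most `n`: there is an exact sequence
`0 → Q_n → ⋯ → Q_0 → M → 0` with each `Q_i` projective. -/
def HasProjDimLE (R : Type) [CommRing R] (M : Type) [AddCommGroup M] [Module R M]
    (n : ℕ) : Prop :=
  ∃ (Q : ℕ → ModuleCat.{0} R) (d : ∀ i : ℕ, ↥(Q (i + 1)) →ₗ[R] ↥(Q i))
    (ε : ↥(Q 0) →ₗ[R] M),
      (∀ i, Module.Projective R ↥(Q i)) ∧ Function.Surjective ε ∧
      Function.Exact (d 0) ε ∧ (∀ i, Function.Exact (d (i + 1)) (d i)) ∧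
      ∀ i, n < i → Subsingleton ↥(Q i)

/-- `M` has injective dimension at most `n`: there is an exact sequence
`0 → M → I⁰ → ⋯ → Iⁿ → 0` with each `I^j` injective. -/
def HasInjDimLE (R : Type) [CommRing R] (M : Type) [AddCommGroup M] [Module R M]
    (n : ℕ) : Prop :=
  ∃ (I : ℕ → ModuleCat.{0} R) (δ : ∀ j : ℕ, ↥(I j) →ₗ[R] ↥(I (j + 1)))
    (ι : M →ₗ[R] ↥(I 0)),
      (∀ j, Module.Injective R ↥(I j)) ∧ Function.Injective ι ∧
      Function.Exact ι (δ 0) ∧ (∀ j, Function.Exact (δ j) (δ (j + 1))) ∧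
      ∀ j, n < j → Subsingleton ↥(I j)


section ExtPart

variable {R : Type} [CommRing R] {C : Type} [AddCommGroup C] [Module R C]
  (P : ℕ → ModuleCat.{0} R) (d : ∀ n, ↥(P (n + 1)) →ₗ[R] ↥(P n)) (ε : ↥(P 0) →ₗ[R] C)

def resCx (h : ∀ n, Function.Exact (d (n + 1)) (d n)) : ChainComplex (ModuleCat.{0} R) ℕ :=
  ChainComplex.of P (fun n => ModuleCat.ofHom (d n)) (fun n => by
    ext x
    exact (h n).apply_apply_eq_zero x)

lemma resCx_d (h : ∀ n, Function.Exact (d (n + 1)) (d n)) (n : ℕ) :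
    (resCx P d h).d (n + 1) n = ModuleCat.ofHom (d n) :=
  ChainComplex.of_d P (fun n => ModuleCat.ofHom (d n)) n

lemma resCx_d' (h : ∀ n, Function.Exact (d (n + 1)) (d n)) (n : ℕ) (x : P (n+1)) :
    ((resCx P d h).d (n + 1) n).hom x = d n x := by
  rw [resCx_d]; rfl

def resPi (h : ∀ n, Function.Exact (d (n + 1)) (d n)) (h0 : Function.Exact (d 0) ε) :
    resCx P d h ⟶ (ChainComplex.single₀ (ModuleCat.{0} R)).obj (ModuleCat.of R C) :=
  (ChainComplex.toSingle₀Equiv _ _).symm ⟨ModuleCat.ofHom ε, by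
    rw [resCx_d]
    ext x
    exact h0.apply_apply_eq_zero x⟩

lemma resPi_f (h : ∀ n, Function.Exact (d (n + 1)) (d n)) (h0 : Function.Exact (d 0) ε) :
    (resPi P d ε h h0).f 0 = ModuleCat.ofHom ε :=
  ChainComplex.toSingle₀Equiv_symm_apply_f_zero _ _

lemma resPi_quasiIso (h : ∀ n, Function.Exact (d (n + 1)) (d n)) (h0 : Function.Exact (d 0) ε)
    (hs : Function.Surjective ε) : QuasiIso (resPi P d ε h h0) where
  quasiIsoAt m := by
    cases m with
    | zero =>
      rw [ChainComplex.quasiIsoAt₀_iff, ShortComplex.quasiIso_iff_of_zeros' _ rfl rfl rfl]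
      constructor
      · rw [ShortComplex.ShortExact.moduleCat_exact_iff_function_exact]
        intro x
        have e1 := h0 x
        have e2 : ∀ x, ((resPi P d ε h h0).f 0).hom x = ε x := fun x => by
          rw [resPi_f]; rfl
        have e3 := resCx_d' P d h 0
        constructor
        · intro hx
          obtain ⟨y, hy⟩ := e1.1 ((e2 x).symm.trans hx)
          exact ⟨y, (e3 y).trans hy⟩
        · rintro ⟨y, hy⟩
          exact (e2 x).trans (e1.2 ⟨y, (e3 y).symm.trans hy⟩)
      · have : Epi ((resPi P d ε h h0).f 0) := by
          rw [resPi_f]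
          exact (ModuleCat.epi_iff_surjective _).2 hs
        exact this
    | succ m =>
      rw [quasiIsoAt_iff_exactAt' (hL := ChainComplex.exactAt_succ_single_obj ..),
          HomologicalComplex.exactAt_iff' _ (m + 2) (m + 1) m (by simp) (by simp)]
      rw [ShortComplex.ShortExact.moduleCat_exact_iff_function_exact]
      intro x
      have e1 := h m x
      have e3 := resCx_d' P d h
      constructor
      · intro hx
        obtain ⟨y, hy⟩ := e1.1 ((e3 m x).symm.trans hx)
        exact ⟨y, (e3 _ y).trans hy⟩
      · rintro ⟨y, hy⟩
        exact (e3 m x).trans (e1.2 ⟨y, (e3 _ y).symm.trans hy⟩)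

def resPR (hp : ∀ n, Module.Projective R (P n))
    (h : ∀ n, Function.Exact (d (n + 1)) (d n)) (h0 : Function.Exact (d 0) ε)
    (hs : Function.Surjective ε) : ProjectiveResolution (ModuleCat.of R C) where
  complex := resCx P d h
  projective n := (IsProjective.iff_projective (R := R) (P n)).1 (hp n)
  π := resPi P d ε h h0
  quasiIso := resPi_quasiIso P d ε h h0 hs

lemma ext_exact (hp : ∀ n, Module.Projective R (P n))
    (h : ∀ n, Function.Exact (d (n + 1)) (d n)) (h0 : Function.Exact (d 0) ε)
    (hs : Function.Surjective ε) (N : Type) [AddCommGroup N] [Module R N]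
    (hE : ∀ i : ℕ, 1 ≤ i → Subsingleton (extMod R C N i)) (i : ℕ)
    (f : P (i + 1) →ₗ[R] N) (hf : f ∘ₗ d (i + 1) = 0) : ∃ g : P i →ₗ[R] N, g ∘ₗ d i = f := by
  have h1 := hE (i + 1) (by omega)
  have h2 : Limits.IsZero (extMod R C N (i + 1)) := ModuleCat.isZero_of_subsingleton _
  have h3 := h2.of_iso ((resPR P d ε hp h h0 hs).isoExt (i + 1) (ModuleCat.of R N)).symm
  rw [← HomologicalComplex.exactAt_iff_isZero_homology,
    HomologicalComplex.exactAt_iff' _ i (i + 1) (i + 2) (by simp) (by simp),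
    ShortComplex.ShortExact.moduleCat_exact_iff_function_exact] at h3
  obtain ⟨g, hg⟩ := (h3 (ModuleCat.ofHom f)).1 (by
    change (resCx P d h).d (i + 2) (i + 1) ≫ ModuleCat.ofHom f = 0
    rw [resCx_d]
    ext x
    exact LinearMap.congr_fun hf x)
  change (resCx P d h).d (i + 1) i ≫ g = ModuleCat.ofHom f at hg
  rw [resCx_d] at hg
  refine ⟨ModuleCat.Hom.hom g, ?_⟩
  ext x
  exact LinearMap.congr_fun (congrArg ModuleCat.Hom.hom hg) x

end ExtPart

section Basics

variable {R : Type} [CommRing R]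

lemma fact_lift {A B D F : Type} [AddCommGroup A] [Module R A] [AddCommGroup B] [Module R B]
    [AddCommGroup D] [Module R D] [AddCommGroup F] [Module R F]
    (j : A →ₗ[R] B) (p : B →ₗ[R] D) (hj : Function.Injective j) (he : Function.Exact j p)
    (g : F →ₗ[R] B) (hg : p ∘ₗ g = 0) : ∃ k : F →ₗ[R] A, j ∘ₗ k = g := by
  have hr : ∀ x, g x ∈ LinearMap.range j := fun x =>
    (he (g x)).1 (LinearMap.congr_fun hg x)
  refine ⟨(LinearEquiv.ofInjective j hj).symm.toLinearMap ∘ₗ g.codRestrict _ hr, ?_⟩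
  ext x
  have := LinearEquiv.apply_symm_apply (LinearEquiv.ofInjective j hj) (g.codRestrict _ hr x)
  exact congrArg Subtype.val this

lemma fact_desc {A B D N : Type} [AddCommGroup A] [Module R A] [AddCommGroup B] [Module R B]
    [AddCommGroup D] [Module R D] [AddCommGroup N] [Module R N]
    (a : A →ₗ[R] B) (e : B →ₗ[R] D) (he : Function.Exact a e) (hs : Function.Surjective e)
    (g : B →ₗ[R] N) (hg : g ∘ₗ a = 0) : ∃ k : D →ₗ[R] N, k ∘ₗ e = g := by
  have hk : LinearMap.ker e ≤ LinearMap.ker g := by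
    intro x hx
    obtain ⟨y, rfl⟩ := (he x).1 hx
    exact LinearMap.congr_fun hg y
  refine ⟨(LinearMap.ker e).liftQ g hk ∘ₗ (e.quotKerEquivOfSurjective hs).symm.toLinearMap, ?_⟩
  ext x
  have : (e.quotKerEquivOfSurjective hs).symm (e x) = (LinearMap.ker e).mkQ x := by
    rw [LinearEquiv.symm_apply_eq]; rfl
  simp only [LinearMap.comp_apply, LinearEquiv.coe_coe, this]
  rfl

lemma det_smul_zero {C : Type} [AddCommGroup C] [Module R C] {r : ℕ}
    (A : Matrix (Fin r) (Fin r) R) (e : Fin r → C) (h : ∀ p, ∑ q, A p q • e q = 0) (s : Fin r) :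
    A.det • e s = 0 := by
  have h1 : ∑ p, A.adjugate s p • ∑ q, A p q • e q = 0 := by simp [h]
  simp only [Finset.smul_sum, smul_smul] at h1
  rw [Finset.sum_comm] at h1
  simp only [← Finset.sum_smul] at h1
  have h2 : ∀ q, ∑ p, A.adjugate s p * A p q = (A.adjugate * A) s q := fun q =>
    (Matrix.mul_apply).symm
  simp only [h2, Matrix.adjugate_mul, Matrix.smul_apply, Matrix.one_apply] at h1
  simpa using h1

/-- A McCoy-type argument: `Hom(C,N) = 0` forces `N = 0` if `C` is finite and faithful. -/
lemma hom_faithful {C N : Type} [AddCommGroup C] [Module R C] [AddCommGroup N] [Module R N]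
    [Module.Finite R C] (hf : ∀ r : R, (∀ c : C, r • c = 0) → r = 0)
    (h : ∀ f : C →ₗ[R] N, f = 0) (x : N) : x = 0 := by
  by_contra hx
  obtain ⟨n, π, hπ⟩ := Module.Finite.exists_fin' R C
  have key : ∀ r : ℕ, ∃ a : Fin r → (Fin n → R), (∀ p, π (a p) = 0) ∧
      ∃ c : Fin r → Fin n, Function.Injective c ∧
        (Matrix.of fun p q => a p (c q)).det • x ≠ 0 := by
    intro r
    induction r with
    | zero => exact ⟨fun _ => 0, fun p => p.elim0, fun p => p.elim0, fun p => p.elim0, by simpa⟩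
    | succ r ih =>
      obtain ⟨a, ha, c, hc, hd⟩ := ih
      by_contra hcon
      by_cases hsurj : Function.Surjective c
      · apply hd
        rw [hf (Matrix.of fun p q => a p (c q)).det, zero_smul]
        intro y
        have h1 : ∀ s, (Matrix.of fun p q => a p (c q)).det • π (Pi.single (c s) 1) = 0 := by
          apply det_smul_zero _ (fun s => π (Pi.single (c s) 1))
          intro p
          rw [← ha p]
          conv_rhs => rw [pi_eq_sum_univ' (a p), map_sum]
          simp only [map_smul, Matrix.of_apply]
          rw [← (Equiv.ofBijective c ⟨hc, hsurj⟩).sum_comp]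
          refine Finset.sum_congr rfl fun q _ => ?_
          congr 2
        obtain ⟨v, rfl⟩ := hπ y
        rw [pi_eq_sum_univ' v, map_sum, Finset.smul_sum]
        refine Finset.sum_eq_zero fun t _ => ?_
        obtain ⟨s, rfl⟩ := hsurj t
        rw [map_smul, smul_comm]
        convert smul_zero (v (c s))
        convert h1 s using 3
      · obtain ⟨j, hj⟩ := not_forall.1 hsurj
        have hj' : ∀ q, c q ≠ j := fun q hq => hj ⟨q, hq⟩
        let c' : Fin (r + 1) → Fin n := Fin.cons j c
        have hc' : Function.Injective c' := by
          rw [Fin.cons_injective_iff]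
          exact ⟨fun ⟨q, hq⟩ => hj' q hq, hc⟩
        let L : (Fin n → R) →ₗ[R] N :=
          (LinearMap.toSpanSingleton R N x) ∘ₗ
            ((Matrix.detRowAlternating (n := Fin (r + 1)) (R := R)).toMultilinearMap.toLinearMap
              (Fin.cons 0 (fun p q => a p (c' q))) 0) ∘ₗ LinearMap.funLeft R R c'
        have hL : ∀ v, L v = (Matrix.of fun p q =>
            (Fin.cons v a : Fin (r + 1) → Fin n → R) p (c' q)).det • x := by
          intro v
          change (Matrix.det (R := R) (n := Fin (r + 1)) (Function.update _ (0 : Fin (r + 1)) _)) • x = _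
          congr 2
          ext p q
          refine Fin.cases ?_ (fun p => ?_) p
          · simp [LinearMap.funLeft]
          · simp
        have hL0 : ∀ v, π v = 0 → L v = 0 := by
          intro v hv
          rw [hL]
          by_contra hne
          exact hcon ⟨Fin.cons v a, fun p => Fin.cases (by simpa using hv) (by simpa using ha) p,
            c', hc', hne⟩
        obtain ⟨k, hk⟩ := fact_desc (LinearMap.ker π).subtype π
          (LinearMap.exact_subtype_ker_map π) hπ L (by
            ext v
            exact hL0 v.1 v.2)
        rw [h k, LinearMap.zero_comp] at hk
        have h2 := hL (Pi.single j 1)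
        rw [← hk, Matrix.det_succ_row_zero, Fin.sum_univ_succ] at h2
        apply hd
        rw [LinearMap.zero_apply, Finset.sum_eq_zero] at h2
        · simp [c'] at h2
          rw [h2]
          rfl
        · intro q _
          simp [c', hj' q]
  obtain ⟨a, -, c, hc, -⟩ := key (n + 1)
  have := Fintype.card_le_of_injective c hc
  simp at this

lemma tensor_faithful {C L : Type} [AddCommGroup C] [Module R C] [AddCommGroup L] [Module R L]
    [Module.Finite R C] (hf : ∀ r : R, (∀ c : C, r • c = 0) → r = 0)
    (h : ∀ z : C ⊗[R] L, z = 0) (x : L) : x = 0 := by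
  have h1 : (LinearMap.id : L →ₗ[R] L) = 0 := by
    refine hom_faithful hf (fun f => ?_) _
    ext c l
    have : TensorProduct.lift f (c ⊗ₜ l) = 0 := by rw [h (c ⊗ₜ l), map_zero]
    simpa using this
  exact LinearMap.congr_fun h1 x

end Basics

section Main

variable {R : Type} [CommRing R] {C : Type} [AddCommGroup C] [Module R C]

/-- The data of a degreewise finite projective resolution. -/
structure FRes (R : Type) [CommRing R] (C : Type) [AddCommGroup C] [Module R C] where
  F : ℕ → ModuleCat.{0} R
  d : ∀ n, ↥(F (n + 1)) →ₗ[R] ↥(F n)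
  e : ↥(F 0) →ₗ[R] C
  fin : ∀ n, Module.Finite R (F n)
  proj : ∀ n, Module.Projective R (F n)
  surj : Function.Surjective e
  ex0 : Function.Exact (d 0) e
  ex : ∀ n, Function.Exact (d (n + 1)) (d n)

lemma FRes.dd (X : FRes R C) (n : ℕ) : X.d n ∘ₗ X.d (n + 1) = 0 := by
  ext x; exact (X.ex n).apply_apply_eq_zero x

lemma FRes.ed (X : FRes R C) : X.e ∘ₗ X.d 0 = 0 := by
  ext x; exact X.ex0.apply_apply_eq_zero x

/-- `Ext^i(C,N) = 0` for `i ≥ 1`, concretely. -/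
def FRes.Acyc (X : FRes R C) (N : Type) [AddCommGroup N] [Module R N] : Prop :=
  ∀ (i : ℕ) (f : X.F (i + 1) →ₗ[R] N), f ∘ₗ X.d (i + 1) = 0 →
    ∃ g : X.F i →ₗ[R] N, g ∘ₗ X.d i = f

lemma FRes.acyc_quot (X : FRes R C)
    {K Q M : Type} [AddCommGroup K] [Module R K] [AddCommGroup Q] [Module R Q]
    [AddCommGroup M] [Module R M] (j : K →ₗ[R] Q) (p : Q →ₗ[R] M) (hj : Function.Injective j)
    (he : Function.Exact j p) (hp : Function.Surjective p)
    (hK : X.Acyc K) (hQ : X.Acyc Q) : X.Acyc M := by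
  intro i f hf
  have := X.proj (i + 1)
  obtain ⟨g, rfl⟩ := Module.projective_lifting_property p f hp
  obtain ⟨k, hk⟩ := fact_lift j p hj he (g ∘ₗ X.d (i + 1)) (by rw [← hf]; rfl)
  have hk0 : k ∘ₗ X.d (i + 2) = 0 := by
    rw [← LinearMap.cancel_left hj, ← LinearMap.comp_assoc, hk, LinearMap.comp_assoc, X.dd]
    simp
  obtain ⟨k', rfl⟩ := hK _ k hk0
  obtain ⟨g', hg'⟩ := hQ i (g - j ∘ₗ k') (by
    rw [LinearMap.sub_comp, ← hk, LinearMap.comp_assoc, sub_self])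
  refine ⟨p ∘ₗ g', ?_⟩
  rw [LinearMap.comp_assoc, hg', LinearMap.comp_sub, ← LinearMap.comp_assoc,
    he.linearMap_comp_eq_zero]
  simp

lemma FRes.hom_surj (X : FRes R C)
    {K Q M : Type} [AddCommGroup K] [Module R K] [AddCommGroup Q] [Module R Q]
    [AddCommGroup M] [Module R M] (j : K →ₗ[R] Q) (p : Q →ₗ[R] M) (hj : Function.Injective j)
    (he : Function.Exact j p) (hp : Function.Surjective p)
    (hK : X.Acyc K) (f : C →ₗ[R] M) : ∃ g : C →ₗ[R] Q, p ∘ₗ g = f := by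
  have := X.proj 0
  obtain ⟨g, hg⟩ := Module.projective_lifting_property p (f ∘ₗ X.e) hp
  obtain ⟨k, hk⟩ := fact_lift j p hj he (g ∘ₗ X.d 0) (by
    rw [← LinearMap.comp_assoc, hg, LinearMap.comp_assoc, X.ed, LinearMap.comp_zero])
  have hk0 : k ∘ₗ X.d 1 = 0 := by
    rw [← LinearMap.cancel_left hj, ← LinearMap.comp_assoc, hk, LinearMap.comp_assoc, X.dd]
    simp
  obtain ⟨k', rfl⟩ := hK _ k hk0
  obtain ⟨g', hg'⟩ := fact_desc (X.d 0) X.e X.ex0 X.surj (g - j ∘ₗ k') (by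
    rw [LinearMap.sub_comp, ← hk, LinearMap.comp_assoc, sub_self])
  refine ⟨g', ?_⟩
  rw [← LinearMap.cancel_right X.surj, LinearMap.comp_assoc, hg', LinearMap.comp_sub, hg,
    ← LinearMap.comp_assoc, he.linearMap_comp_eq_zero]
  simp

/-- The Auslander-class condition (without Tor). -/
def FRes.Aus (X : FRes R C) (M : Type) [AddCommGroup M] [Module R M] : Prop :=
  Function.Bijective (muMap R C M) ∧ X.Acyc (C ⊗[R] M)

lemma mu_apply (M : Type) [AddCommGroup M] [Module R M] (m : M) (c : C) :
    muMap R C M m c = c ⊗ₜ m := rfl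

lemma mu_nat {M N : Type} [AddCommGroup M] [Module R M] [AddCommGroup N] [Module R N]
    (f : M →ₗ[R] N) (m : M) : f.lTensor C ∘ₗ muMap R C M m = muMap R C N (f m) := by
  ext c; simp [mu_apply]

lemma FRes.aus_proj (X : FRes R C) (hbij : Function.Bijective (fun r : R => (r • LinearMap.id : C →ₗ[R] C)))
    (hC : X.Acyc C) (P : Type) [AddCommGroup P] [Module R P] [Module.Projective R P] :
    X.Aus P := by
  have := X.proj
  have := X.fin
  have nat : ∀ (A B : Type) [AddCommGroup A] [Module R A] [AddCommGroup B] [Module R B]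
      (a : A →ₗ[R] B) (z : (B →ₗ[R] C) ⊗[R] P),
      rTensorHomToHomRTensor (.id R) A C P ((LinearMap.lcomp R C a).rTensor P z) =
        rTensorHomToHomRTensor (.id R) B C P z ∘ₗ a := by
    intro A B _ _ _ _ a z
    induction z with
    | zero => simp
    | add x y hx hy => simp [hx, hy, LinearMap.add_comp]
    | tmul f q => ext; simp
  have bij : ∀ i, Function.Bijective (rTensorHomToHomRTensor (.id R) (X.F i) C P) := by
    intro i
    have h1 := (rTensorHomEquivHomRTensor R (X.F i) C P).bijective
    convert h1 using 1
    ext1 z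
    exact (rTensorHomEquivHomRTensor_apply z).symm
  let r : R →ₗ[R] (X.F 0 →ₗ[R] C) := LinearMap.toSpanSingleton R _ X.e
  have hr : Function.Injective r := by
    intro a b hab
    apply hbij.1
    change a • X.e = b • X.e at hab
    ext c
    obtain ⟨y, rfl⟩ := X.surj c
    exact LinearMap.congr_fun hab y
  have hr0 : Function.Exact r (LinearMap.lcomp R C (X.d 0)) := by
    intro f
    constructor
    · intro hf
      obtain ⟨g, rfl⟩ := fact_desc (X.d 0) X.e X.ex0 X.surj f hf
      obtain ⟨a, rfl⟩ := hbij.2 g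
      exact ⟨a, by ext; simp [r]⟩
    · rintro ⟨a, rfl⟩
      change (a • X.e) ∘ₗ X.d 0 = 0
      rw [LinearMap.smul_comp, X.ed, smul_zero]
  have hrP : ∀ q : P, rTensorHomToHomRTensor (.id R) (X.F 0) C P (r.rTensor P (1 ⊗ₜ q)) =
      muMap R C P q ∘ₗ X.e := by
    intro q
    ext y
    simp [r, mu_apply]
  refine ⟨⟨?_, ?_⟩, ?_⟩
  · rw [injective_iff_map_eq_zero]
    intro q hq
    have h1 := hrP q
    rw [hq, LinearMap.zero_comp] at h1
    have h2 : r.rTensor P (1 ⊗ₜ q) = 0 := (bij 0).1 (by rw [h1, map_zero])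
    have h3 : (1 : R) ⊗ₜ[R] q = 0 :=
      Module.Flat.rTensor_preserves_injective_linearMap r hr (by rw [h2, map_zero])
    simpa using congrArg (TensorProduct.lid R P) h3
  · intro f
    obtain ⟨z, hz⟩ := (bij 0).2 (f ∘ₗ X.e)
    have h1 : (LinearMap.lcomp R C (X.d 0)).rTensor P z = 0 := by
      apply (bij 1).1
      rw [nat, hz, LinearMap.comp_assoc, X.ed, LinearMap.comp_zero, map_zero]
    obtain ⟨w, rfl⟩ := (Module.Flat.rTensor_exact P hr0 z).1 h1
    obtain ⟨q, rfl⟩ := (TensorProduct.lid R P).symm.surjective w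
    refine ⟨q, ?_⟩
    rw [← LinearMap.cancel_right X.surj, ← hz, TensorProduct.lid_symm_apply, hrP]
  · intro i f hf
    obtain ⟨z, rfl⟩ := (bij (i + 1)).2 f
    have h1 : (LinearMap.lcomp R C (X.d (i + 1))).rTensor P z = 0 := by
      apply (bij (i + 2)).1
      rw [nat, hf, map_zero]
    have hex : Function.Exact (LinearMap.lcomp R C (X.d i)) (LinearMap.lcomp R C (X.d (i + 1))) := by
      intro f
      constructor
      · intro hf
        exact hC i f hf
      · rintro ⟨a, rfl⟩
        change (a ∘ₗ X.d i) ∘ₗ X.d (i + 1) = 0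
        rw [LinearMap.comp_assoc, X.dd, LinearMap.comp_zero]
    obtain ⟨w, rfl⟩ := (Module.Flat.rTensor_exact P hex z).1 h1
    exact ⟨_, (nat _ _ _ _).symm⟩

end Main

section Final

variable {R : Type} [CommRing R] {C : Type} [AddCommGroup C] [Module R C]

lemma inj_tensor [Module.Finite R C] (hf : ∀ r : R, (∀ c : C, r • c = 0) → r = 0)
    {K Q : Type} [AddCommGroup K] [Module R K] [AddCommGroup Q] [Module R Q]
    (j : K →ₗ[R] Q) (hj : Function.Injective j) (hK : Function.Surjective (muMap R C K))
    (hQ : Function.Injective (muMap R C Q)) : Function.Injective (j.lTensor C) := by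
  rw [← LinearMap.ker_eq_bot, LinearMap.ker_eq_bot']
  intro z hz
  have key : ∀ x : LinearMap.ker (j.lTensor C), x = 0 := by
    refine hom_faithful hf (fun f => ?_)
    obtain ⟨k, hk⟩ := hK ((LinearMap.ker (j.lTensor C)).subtype ∘ₗ f)
    have h1 : muMap R C Q (j k) = 0 := by
      rw [← mu_nat, hk]
      ext c
      exact (f c).2
    have h2 : k = 0 := hj (by rw [map_zero]; exact hQ (by rw [h1, map_zero]))
    rw [h2, map_zero] at hk
    ext c
    exact (LinearMap.congr_fun hk c).symm
  exact congrArg Subtype.val (key ⟨z, hz⟩)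

lemma FRes.aus_quot (X : FRes R C) [Module.Finite R C]
    (hf : ∀ r : R, (∀ c : C, r • c = 0) → r = 0)
    {K Q M : Type} [AddCommGroup K] [Module R K] [AddCommGroup Q] [Module R Q]
    [AddCommGroup M] [Module R M] (j : K →ₗ[R] Q) (p : Q →ₗ[R] M) (hj : Function.Injective j)
    (he : Function.Exact j p) (hp : Function.Surjective p) (hK : X.Aus K) (hQ : X.Aus Q) :
    X.Aus M := by
  have hj' := inj_tensor hf j hj hK.1.2 hQ.1.1
  have he' := lTensor_exact C he hp
  have hp' := LinearMap.lTensor_surjective C hp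
  refine ⟨⟨?_, ?_⟩, X.acyc_quot _ _ hj' he' hp' hK.2 hQ.2⟩
  · rw [injective_iff_map_eq_zero]
    intro m hm
    obtain ⟨q, rfl⟩ := hp m
    rw [← mu_nat] at hm
    obtain ⟨g, hg⟩ := fact_lift _ _ hj' he' _ hm
    obtain ⟨k, rfl⟩ := hK.1.2 g
    rw [mu_nat] at hg
    rw [← hQ.1.1 hg]
    exact he.apply_apply_eq_zero k
  · intro f
    obtain ⟨g, rfl⟩ := X.hom_surj _ _ hj' he' hp' hK.2 f
    obtain ⟨q, rfl⟩ := hQ.1.2 g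
    exact ⟨p q, (mu_nat _ _).symm⟩

/-- Projective dimension `< n`. -/
def PD (R : Type) [CommRing R] (M : Type) [AddCommGroup M] [Module R M]
    (n : ℕ) : Prop :=
  ∃ (Q : ℕ → ModuleCat.{0} R) (d : ∀ i : ℕ, ↥(Q (i + 1)) →ₗ[R] ↥(Q i))
    (ε : ↥(Q 0) →ₗ[R] M),
      (∀ i, Module.Projective R ↥(Q i)) ∧ Function.Surjective ε ∧
      Function.Exact (d 0) ε ∧ (∀ i, Function.Exact (d (i + 1)) (d i)) ∧
      ∀ i, n ≤ i → Subsingleton ↥(Q i)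

/-- `P_C`-projective dimension `< n`. -/
def CR (R : Type) [CommRing R] (C : Type) [AddCommGroup C] [Module R C]
    (M : Type) [AddCommGroup M] [Module R M] (n : ℕ) : Prop :=
  ∃ (P : ℕ → ModuleCat.{0} R)
    (d : ∀ i : ℕ, (C ⊗[R] ↥(P (i + 1))) →ₗ[R] (C ⊗[R] ↥(P i)))
    (ε : (C ⊗[R] ↥(P 0)) →ₗ[R] M),
      (∀ i, Module.Projective R ↥(P i)) ∧ ResExact R C M P d ε ∧
      ∀ i, n ≤ i → Subsingleton (C ⊗[R] ↥(P i))

lemma exact_codRestrict {A B D : Type} [AddCommGroup A] [Module R A] [AddCommGroup B] [Module R B]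
    [AddCommGroup D] [Module R D] (S : Submodule R D) (a : A →ₗ[R] B) (b : B →ₗ[R] D)
    (hb : ∀ x, b x ∈ S) (h : Function.Exact a b) : Function.Exact a (b.codRestrict S hb) := by
  intro x
  rw [← h x]
  exact ⟨fun h => congrArg Subtype.val h, fun h => Subtype.ext h⟩

lemma exact_comp_inj {A B D E : Type} [AddCommGroup A] [Module R A] [AddCommGroup B] [Module R B]
    [AddCommGroup D] [Module R D] [AddCommGroup E] [Module R E] (a : A →ₗ[R] B) (b : B →ₗ[R] D)
    (j : D →ₗ[R] E) (hj : Function.Injective j) (h : Function.Exact a b) :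
    Function.Exact a (j ∘ₗ b) := by
  intro x
  rw [← h x]
  exact map_eq_zero_iff j hj

lemma exact_comp_surj {A B D E : Type} [AddCommGroup A] [Module R A] [AddCommGroup B] [Module R B]
    [AddCommGroup D] [Module R D] [AddCommGroup E] [Module R E] (a : A →ₗ[R] B) (b : B →ₗ[R] D)
    (c : D →ₗ[R] E) (ha : Function.Surjective a) (h : Function.Exact b c) :
    Function.Exact (b ∘ₗ a) c := by
  intro x
  rw [h x]
  constructor
  · rintro ⟨y, rfl⟩
    obtain ⟨z, rfl⟩ := ha y
    exact ⟨z, rfl⟩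
  · rintro ⟨z, rfl⟩
    exact ⟨a z, rfl⟩

lemma PD.unsplice {M : Type} [AddCommGroup M] [Module R M] {n : ℕ} (h : PD R M (n + 1)) :
    ∃ (P : ModuleCat.{0} R) (ε : P →ₗ[R] M), Module.Projective R P ∧ Function.Surjective ε ∧
      PD R (LinearMap.ker ε) n := by
  obtain ⟨Q, d, ε, hp, hs, h0, he, hn⟩ := h
  refine ⟨Q 0, ε, hp 0, hs, fun i => Q (i + 1), fun i => d (i + 1),
    (d 0).codRestrict _ (fun x => h0.apply_apply_eq_zero x), fun i => hp _, ?_,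
    exact_codRestrict _ _ _ _ (he 0), fun i => he _, fun i hi => hn _ (by omega)⟩
  rintro ⟨y, hy⟩
  obtain ⟨z, rfl⟩ := (h0 y).1 hy
  exact ⟨z, rfl⟩

lemma CR.unsplice {M : Type} [AddCommGroup M] [Module R M] {n : ℕ} (h : CR R C M (n + 1)) :
    ∃ (P : ModuleCat.{0} R) (ε : C ⊗[R] P →ₗ[R] M), Module.Projective R P ∧
      Function.Surjective ε ∧ CR R C (LinearMap.ker ε) n := by
  obtain ⟨Q, d, ε, hp, ⟨hs, h0, he⟩, hn⟩ := h
  refine ⟨Q 0, ε, hp 0, hs, fun i => Q (i + 1), fun i => d (i + 1),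
    (d 0).codRestrict _ (fun x => h0.apply_apply_eq_zero x), fun i => hp _, ⟨?_,
    exact_codRestrict _ _ _ _ (he 0), fun i => he _⟩, fun i hi => hn _ (by omega)⟩
  rintro ⟨y, hy⟩
  obtain ⟨z, rfl⟩ := (h0 y).1 hy
  exact ⟨z, rfl⟩

/-- Prepend a module to a sequence of modules. -/
abbrev consMod (P : ModuleCat.{0} R) (Q : ℕ → ModuleCat.{0} R) : ℕ → ModuleCat.{0} R
  | 0 => P
  | i + 1 => Q i

/-- Prepend a differential. -/
def consD (P : ModuleCat.{0} R) (Q : ℕ → ModuleCat.{0} R) (j : Q 0 →ₗ[R] P)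
    (d : ∀ i : ℕ, ↥(Q (i + 1)) →ₗ[R] ↥(Q i)) :
    ∀ i : ℕ, ↥(consMod P Q (i + 1)) →ₗ[R] ↥(consMod P Q i)
  | 0 => j
  | i + 1 => d i

/-- Prepend a differential after tensoring. -/
def consDT (P : ModuleCat.{0} R) (Q : ℕ → ModuleCat.{0} R) (j : C ⊗[R] Q 0 →ₗ[R] C ⊗[R] P)
    (d : ∀ i : ℕ, C ⊗[R] ↥(Q (i + 1)) →ₗ[R] C ⊗[R] ↥(Q i)) :
    ∀ i : ℕ, C ⊗[R] ↥(consMod P Q (i + 1)) →ₗ[R] C ⊗[R] ↥(consMod P Q i)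
  | 0 => j
  | i + 1 => d i

lemma PD.splice {K M : Type} [AddCommGroup K] [Module R K] [AddCommGroup M] [Module R M] {n : ℕ}
    (h : PD R K n) (P : ModuleCat.{0} R) [Module.Projective R P] (j : K →ₗ[R] P) (p : P →ₗ[R] M)
    (hj : Function.Injective j) (hex : Function.Exact j p) (hs : Function.Surjective p) :
    PD R M (n + 1) := by
  obtain ⟨Q, d, ε, hp, hs', h0, he, hn⟩ := h
  refine ⟨consMod P Q, consD P Q (j ∘ₗ ε) d, p, ?_, hs, exact_comp_surj _ _ _ hs' hex, ?_, ?_⟩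
  · rintro (_ | i)
    · assumption
    · exact hp i
  · rintro (_ | i)
    · exact exact_comp_inj _ _ _ hj h0
    · exact he i
  · rintro (_ | i) hi
    · omega
    · exact hn i (by omega)

lemma CR.splice {K M : Type} [AddCommGroup K] [Module R K] [AddCommGroup M] [Module R M] {n : ℕ}
    (h : CR R C K n) (P : ModuleCat.{0} R) [Module.Projective R P] (j : K →ₗ[R] C ⊗[R] P)
    (p : C ⊗[R] P →ₗ[R] M)
    (hj : Function.Injective j) (hex : Function.Exact j p) (hs : Function.Surjective p) :
    CR R C M (n + 1) := by
  obtain ⟨Q, d, ε, hp, ⟨hs', h0, he⟩, hn⟩ := h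
  refine ⟨consMod P Q, consDT P Q (j ∘ₗ ε) d, p, ?_, ⟨hs, exact_comp_surj _ _ _ hs' hex, ?_⟩, ?_⟩
  · rintro (_ | i)
    · assumption
    · exact hp i
  · rintro (_ | i)
    · exact exact_comp_inj _ _ _ hj h0
    · exact he i
  · rintro (_ | i) hi
    · omega
    · exact hn i (by omega)

lemma exact_of_subsingleton {A B D : Type} [AddCommGroup A] [Module R A] [AddCommGroup B]
    [Module R B] [AddCommGroup D] [Module R D] [Subsingleton B] (a : A →ₗ[R] B) (b : B →ₗ[R] D) :
    Function.Exact a b := by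
  intro x
  obtain rfl : x = 0 := Subsingleton.elim _ _
  simp only [map_zero, true_iff]
  exact ⟨0, map_zero a⟩

lemma tens_sub (M : Type) [AddCommGroup M] [Module R M] [Subsingleton M] :
    Subsingleton (C ⊗[R] M) := by
  refine subsingleton_of_forall_eq 0 fun z => ?_
  induction z with
  | zero => rfl
  | add x y hx hy => rw [hx, hy, add_zero]
  | tmul c m => rw [Subsingleton.elim m 0, TensorProduct.tmul_zero]

lemma FRes.forward (X : FRes R C) [Module.Finite R C]
    (hf : ∀ r : R, (∀ c : C, r • c = 0) → r = 0)
    (hP : ∀ (P : Type) [AddCommGroup P] [Module R P] [Module.Projective R P], X.Aus P) (n : ℕ) :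
    ∀ (M : Type) [AddCommGroup M] [Module R M], PD R M n →
      X.Aus M ∧ CR R C (C ⊗[R] M) n := by
  induction n with
  | zero =>
    intro M _ _ h
    obtain ⟨Q, d, ε, hp, hs, h0, he, hn⟩ := h
    have := hn 0 le_rfl
    have hM : Subsingleton M := hs.subsingleton
    have : Subsingleton (C ⊗[R] M) := tens_sub _
    refine ⟨⟨⟨fun a b _ => Subsingleton.elim _ _, fun f => ⟨0, ?_⟩⟩, ?_⟩, ?_⟩
    · ext c; exact Subsingleton.elim _ _
    · intro i f _
      exact ⟨0, by ext x; exact Subsingleton.elim _ _⟩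
    · have : ∀ i, Subsingleton (C ⊗[R] Q i) := fun i => by
        have := hn i (Nat.zero_le _)
        exact tens_sub _
      exact ⟨Q, fun i => 0, 0, hp, ⟨fun x => ⟨0, Subsingleton.elim _ _⟩,
        exact_of_subsingleton _ _, fun i => exact_of_subsingleton _ _⟩, fun i _ => this i⟩
  | succ n ih =>
    intro M _ _ h
    obtain ⟨P, ε, hp, hs, hk⟩ := h.unsplice
    obtain ⟨hA, hR⟩ := ih _ hk
    have hj := (LinearMap.ker ε).injective_subtype
    have hex := LinearMap.exact_subtype_ker_map ε
    exact ⟨X.aus_quot hf _ ε hj hex hs hA (hP P),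
      hR.splice P _ _ (inj_tensor hf _ hj hA.1.2 (hP P).1.1) (lTensor_exact C hex hs)
        (LinearMap.lTensor_surjective C hs)⟩

lemma evalNu_tmul (N : Type) [AddCommGroup N] [Module R N] (c : C) (f : C →ₗ[R] N) :
    evalNu R C N (c ⊗ₜ f) = f c := by
  simp [evalNu]

lemma evalNu_mu (M : Type) [AddCommGroup M] [Module R M] :
    evalNu R C (C ⊗[R] M) ∘ₗ (muMap R C M).lTensor C = LinearMap.id := by
  ext c m
  simp [evalNu_tmul, mu_apply]

lemma evalNu_nat {N N' : Type} [AddCommGroup N] [Module R N] [AddCommGroup N'] [Module R N']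
    (f : N →ₗ[R] N') :
    evalNu R C N' ∘ₗ (LinearMap.compRight R f : (C →ₗ[R] N) →ₗ[R] (C →ₗ[R] N')).lTensor C =
      f ∘ₗ evalNu R C N := by
  ext c g
  simp [evalNu_tmul]

lemma FRes.backward_step (X : FRes R C) {K N : Type} [AddCommGroup K] [Module R K]
    [AddCommGroup N] [Module R N] (P : ModuleCat.{0} R) [Module.Projective R P]
    (hPP : X.Aus P) {n : ℕ} (j : K →ₗ[R] C ⊗[R] P) (ε : C ⊗[R] P →ₗ[R] N)
    (hj : Function.Injective j) (hex : Function.Exact j ε) (hs : Function.Surjective ε)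
    (hA : X.Acyc K) (hR : PD R (C →ₗ[R] K) n) (hν : Function.Bijective (evalNu R C K)) :
    X.Acyc N ∧ PD R (C →ₗ[R] N) (n + 1) ∧ Function.Bijective (evalNu R C N) := by
  let μ : P ≃ₗ[R] (C →ₗ[R] C ⊗[R] P) := LinearEquiv.ofBijective _ hPP.1
  let a : (C →ₗ[R] K) →ₗ[R] P :=
    μ.symm.toLinearMap ∘ₗ LinearMap.compRight R j
  let b : P →ₗ[R] (C →ₗ[R] N) := LinearMap.compRight R ε ∘ₗ muMap R C P
  have hμa : ∀ f, muMap R C P (a f) = j ∘ₗ f := fun f =>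
    μ.apply_symm_apply _
  have ha : Function.Injective a := by
    intro f g hfg
    have := congrArg (muMap R C P) hfg
    rw [hμa, hμa] at this
    exact (LinearMap.cancel_left hj).1 this
  have hb : Function.Surjective b := by
    intro f
    obtain ⟨g, rfl⟩ := X.hom_surj _ _ hj hex hs hA f
    obtain ⟨q, rfl⟩ := hPP.1.2 g
    exact ⟨q, rfl⟩
  have hab : Function.Exact a b := by
    intro q
    constructor
    · intro hq
      obtain ⟨g, hg⟩ := fact_lift _ _ hj hex (muMap R C P q) hq
      exact ⟨g, hPP.1.1 (by rw [hμa, hg])⟩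
    · rintro ⟨g, rfl⟩
      change ε ∘ₗ muMap R C P (a g) = 0
      rw [hμa]
      rw [← LinearMap.comp_assoc, hex.linearMap_comp_eq_zero, LinearMap.zero_comp]
  have sq1 : (a.lTensor C) = j ∘ₗ evalNu R C _ := by
    ext c f
    have := LinearMap.congr_fun (hμa f) c
    simpa [evalNu_tmul, mu_apply] using this
  have sq2 : evalNu R C N ∘ₗ b.lTensor C = ε := by
    ext c q
    simp [evalNu_tmul, b, mu_apply]
  have hbT := LinearMap.lTensor_surjective C hb
  refine ⟨X.acyc_quot _ _ hj hex hs hA hPP.2, hR.splice P a b ha hab hb, ?_, ?_⟩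
  · rw [injective_iff_map_eq_zero]
    intro z hz
    obtain ⟨w, rfl⟩ := hbT z
    have h1 : ε w = 0 := by rw [← LinearMap.comp_apply, sq2] at hz; exact hz
    obtain ⟨k, hk⟩ := (hex w).1 h1
    obtain ⟨y, hy⟩ := hν.2 k
    have h2 : a.lTensor C y = w := by rw [sq1, LinearMap.comp_apply, hy, hk]
    exact (lTensor_exact C hab hb w).2 ⟨y, h2⟩
  · intro x
    obtain ⟨w, rfl⟩ := hs x
    exact ⟨b.lTensor C w, by rw [← LinearMap.comp_apply, sq2]⟩

lemma FRes.backward (X : FRes R C)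
    (hP : ∀ (P : Type) [AddCommGroup P] [Module R P] [Module.Projective R P], X.Aus P) (n : ℕ) :
    ∀ (N : Type) [AddCommGroup N] [Module R N], CR R C N n →
      X.Acyc N ∧ PD R (C →ₗ[R] N) n ∧ Function.Bijective (evalNu R C N) := by
  induction n with
  | zero =>
    intro N _ _ h
    obtain ⟨Q, d, ε, hp, ⟨hs, h0, he⟩, hn⟩ := h
    have := hn 0 le_rfl
    have hM : Subsingleton N := hs.subsingleton
    have hH : Subsingleton (C →ₗ[R] N) :=
      ⟨fun a b => by ext c; exact Subsingleton.elim _ _⟩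
    have : Subsingleton (C ⊗[R] (C →ₗ[R] N)) := tens_sub _
    refine ⟨?_, ?_, fun a b _ => Subsingleton.elim _ _, fun x => ⟨0, Subsingleton.elim _ _⟩⟩
    · intro i f _
      exact ⟨0, by ext x; exact Subsingleton.elim _ _⟩
    · exact ⟨fun _ => ModuleCat.of R PUnit, fun i => 0, 0, fun i => inferInstance,
        fun x => ⟨0, Subsingleton.elim _ _⟩,
        exact_of_subsingleton (B := PUnit) _ _, fun i => exact_of_subsingleton (B := PUnit) _ _,
        fun i _ => inferInstanceAs (Subsingleton PUnit)⟩
  | succ n ih =>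
    intro N _ _ h
    obtain ⟨P, ε, hp, hs, hk⟩ := h.unsplice
    obtain ⟨hA, hR, hν⟩ := ih _ hk
    have hj := (LinearMap.ker ε).injective_subtype
    have hex := LinearMap.exact_subtype_ker_map ε
    exact X.backward_step P (hP P) _ ε hj hex hs hA hR hν

lemma PD.congr {M N : Type} [AddCommGroup M] [Module R M] [AddCommGroup N] [Module R N] {n : ℕ}
    (h : PD R M n) (e : M ≃ₗ[R] N) : PD R N n := by
  obtain ⟨Q, d, ε, hp, hs, h0, he, hn⟩ := h
  exact ⟨Q, d, e.toLinearMap ∘ₗ ε, hp, e.surjective.comp hs,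
    exact_comp_inj _ _ _ e.injective h0, he, hn⟩

/-- `Tor_1(C,X) = 0` when `X = P/K` and `C ⊗ K → C ⊗ P` is injective. -/
lemma tor_one {K P X M L : Type} [AddCommGroup K] [Module R K] [AddCommGroup P] [Module R P]
    [AddCommGroup X] [Module R X] [AddCommGroup M] [Module R M] [AddCommGroup L] [Module R L]
    [Module.Projective R P] (j : K →ₗ[R] P) (p : P →ₗ[R] X)
    (hex : Function.Exact j p) (hp : Function.Surjective p)
    (hj : Function.Injective (j.lTensor C)) (i : L →ₗ[R] M) (q : M →ₗ[R] X)
    (hi : Function.Injective i) (hiq : Function.Exact i q) (hq : Function.Surjective q) :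
    Function.Injective (i.lTensor C) := by
  obtain ⟨l, hl⟩ := Module.projective_lifting_property q p hq
  obtain ⟨k, hk⟩ := fact_lift i q hi hiq (l ∘ₗ j) (by
    rw [← LinearMap.comp_assoc, hl, hex.linearMap_comp_eq_zero])
  let s : L × P →ₗ[R] M := i.coprod l
  let t : K →ₗ[R] L × P := (-k).prod j
  have hs : Function.Surjective s := by
    intro m
    obtain ⟨y, hy⟩ := hp (q m)
    have : q (m - l y) = 0 := by
      rw [map_sub, ← hy, ← hl]; simp
    obtain ⟨z, hz⟩ := (hiq _).1 this
    exact ⟨(z, y), by simp [s, hz]⟩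
  have hst : Function.Exact t s := by
    rintro ⟨z, y⟩
    constructor
    · intro h
      have h' : i z + l y = 0 := by simpa [s] using h
      have h1 : p y = 0 := by
        rw [← hl, LinearMap.comp_apply, eq_neg_of_add_eq_zero_right h', map_neg,
          hiq.apply_apply_eq_zero, neg_zero]
      obtain ⟨x, rfl⟩ := (hex _).1 h1
      refine ⟨x, ?_⟩
      have h2 : i (k x) = l (j x) := LinearMap.congr_fun hk x
      have h3 : z = - k x := by
        apply hi
        rw [map_neg, h2]
        exact eq_neg_of_add_eq_zero_left h'
      simp [t, h3]
    · rintro ⟨x, hx⟩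
      have h2 : i (k x) = l (j x) := LinearMap.congr_fun hk x
      rw [← hx]
      simp [s, t, h2]
  rw [injective_iff_map_eq_zero]
  intro z hz
  have h1 : s.lTensor C ((LinearMap.inl R L P).lTensor C z) = 0 := by
    rw [← LinearMap.comp_apply, ← LinearMap.lTensor_comp]
    have : s ∘ₗ LinearMap.inl R L P = i := by simp [s]
    rw [this, hz]
  obtain ⟨w, hw⟩ := (lTensor_exact C hst hs _).1 h1
  have h2 : j.lTensor C w = 0 := by
    have : j = LinearMap.snd R L P ∘ₗ t := by simp [t]
    rw [this, LinearMap.lTensor_comp, LinearMap.comp_apply, hw, ← LinearMap.comp_apply,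
      ← LinearMap.lTensor_comp]
    simp
  have h3 : w = 0 := hj (by rw [h2, map_zero])
  rw [h3, map_zero] at hw
  have h4 : (LinearMap.fst R L P).lTensor C ((LinearMap.inl R L P).lTensor C z) = z := by
    rw [← LinearMap.comp_apply, ← LinearMap.lTensor_comp]
    simp
  rw [← h4, ← hw, map_zero]

end Final

/-- `M` has projective dimension at most `n` iff there is an exact sequence
`0 → C ⊗ P_n → ⋯ → C ⊗ P_0 → C ⊗ M → 0` with each `P_i` projective; that is,
`pd_R(M) = P_C-pd(C ⊗_R M)`. -/
theorem projDimLE_iff_boundedExactCRes_tensor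
    (R : Type) [CommRing R] (C : Type) [AddCommGroup C] [Module R C]
    (M : Type) [AddCommGroup M] [Module R M] (hC : IsSemidualizing R C) (n : ℕ) :
    HasProjDimLE R M n ↔ HasBoundedExactCRes R C (C ⊗[R] M) n := by
  obtain ⟨⟨F, d, e, hfin, hproj, hs, h0, hex⟩, hbij, hext⟩ := hC
  let X : FRes R C := ⟨F, d, e, hfin, hproj, hs, h0, hex⟩
  have hXC : X.Acyc C := ext_exact F d e hproj hex h0 hs C hext
  have hP : ∀ (P : Type) [AddCommGroup P] [Module R P] [Module.Projective R P], X.Aus P :=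
    fun P _ _ _ => X.aus_proj hbij hXC P
  have : Module.Finite R C := by
    have := hfin 0
    exact Module.Finite.of_surjective e hs
  have hf : ∀ r : R, (∀ c : C, r • c = 0) → r = 0 := by
    intro r hr
    apply hbij.1
    ext c
    simpa using hr c
  constructor
  · intro h
    exact (X.forward hf hP (n + 1) M h).2
  · intro h
    obtain ⟨-, hPD, hν⟩ := X.backward hP (n + 1) _ h
    have hnm := fun z => LinearMap.congr_fun (evalNu_mu (R := R) (C := C) M) z
    have hinj : Function.Injective ((muMap R C M).lTensor C) := fun a b hab => by
      have := congrArg (evalNu R C (C ⊗[R] M)) hab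
      exact (hnm a).symm.trans (this.trans (hnm b))
    have hsur : Function.Surjective ((muMap R C M).lTensor C) := fun z =>
      ⟨evalNu R C _ z, hν.1 (hnm _)⟩
    have hμs : Function.Surjective (muMap R C M) := by
      rw [← LinearMap.range_eq_top, ← Submodule.ker_mkQ (LinearMap.range (muMap R C M)),
        LinearMap.ker_eq_top]
      set q := (LinearMap.range (muMap R C M)).mkQ with hq
      ext1 y
      refine tensor_faithful hf (fun z => ?_) _
      obtain ⟨w, rfl⟩ := LinearMap.lTensor_surjective C
        (Submodule.mkQ_surjective (LinearMap.range (muMap R C M))) z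
      obtain ⟨v, rfl⟩ := hsur w
      rw [← LinearMap.comp_apply, ← LinearMap.lTensor_comp, LinearMap.range_mkQ_comp]
      simp
    have hμi : Function.Injective (muMap R C M) := by
      obtain ⟨P, ε, hp, hs', hk⟩ := hPD.unsplice
      have hA := (X.forward hf hP n _ hk).1
      have hj := (LinearMap.ker ε).injective_subtype
      have hT := tor_one (C := C) _ ε (LinearMap.exact_subtype_ker_map ε) hs'
        (inj_tensor hf _ hj hA.1.2 (hP P).1.1) (LinearMap.ker (muMap R C M)).subtype
        (muMap R C M) (LinearMap.ker (muMap R C M)).injective_subtype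
        (LinearMap.exact_subtype_ker_map _) hμs
      rw [← LinearMap.ker_eq_bot, LinearMap.ker_eq_bot']
      intro m hm
      have key : ∀ x : LinearMap.ker (muMap R C M), x = 0 := by
        refine tensor_faithful hf (fun z => hT (hinj ?_))
        rw [map_zero, map_zero]
        exact (lTensor_exact C (LinearMap.exact_subtype_ker_map (muMap R C M))
          hμs).apply_apply_eq_zero z
      exact congrArg Subtype.val (key ⟨m, hm⟩)
    exact hPD.congr (LinearEquiv.ofBijective _ ⟨hμi, hμs⟩).symm

end
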